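/- Let J : ℝ^n → ℝ be differentiable with L-Lipschitz gradient (L > 0), let α ∈ (0, 1), let W ∈ ℝ^n and s ∈ ℝ^n with s ≠ 0 and ⟨∇J(W), s⟩ > 0. Then with the step size Δ = 2(1 − α)·⟨∇J(W), s⟩ / (L·‖s‖²), the objective improves by at least J(W + Δ·s) − J(W) ≥ (2α(1 − α)/L)·⟨∇J(W), s⟩² / ‖s‖². -/

import Mathlib

open scoped RealInnerProductSpace

/-- Quadratic lower bound (descent lemma) for a function with `L`-Lipschitz gradient. -/
theorem add_inner_gradient_sub_le_of_lipschitz_gradient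
    {E : Type*} [NormedAddCommGroup E] [InnerProductSpace ℝ E] [CompleteSpace E]
    {J : E → ℝ} {L : ℝ} (hdiff : Differentiable ℝ J)
    (hlip : ∀ u v : E, ‖gradient J u - gradient J v‖ ≤ L * ‖u - v‖) (x v : E) :
    J x + ⟪gradient J x, v⟫ - L / 2 * ‖v‖ ^ 2 ≤ J (x + v) := by
  let g : ℝ → ℝ := fun t =>
    J (x + t • v) - t * ⟪gradient J x, v⟫ + L / 2 * ‖v‖ ^ 2 * t ^ 2
  have hg : ∀ t : ℝ, HasDerivAt g
      (⟪gradient J (x + t • v), v⟫ - ⟪gradient J x, v⟫ + L * ‖v‖ ^ 2 * t) t := by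
    intro t
    have hline : HasDerivAt (fun t : ℝ => x + t • v) v t := by
      simpa using ((hasDerivAt_id t).smul_const v).const_add x
    have hJ : HasDerivAt (fun t : ℝ => J (x + t • v)) ⟪gradient J (x + t • v), v⟫ t := by
      have hcomp := (hdiff (x + t • v)).hasFDerivAt.comp_hasDerivAt t hline
      refine HasDerivAt.congr_deriv hcomp ?_
      simp [gradient]
    refine ((hJ.sub ((hasDerivAt_id t).mul_const ⟪gradient J x, v⟫)).add
      ((hasDerivAt_pow 2 t).const_mul (L / 2 * ‖v‖ ^ 2))).congr_deriv ?_
    norm_num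
    ring
  have hmono : MonotoneOn g (Set.Icc 0 1) := by
    refine monotoneOn_of_deriv_nonneg (convex_Icc 0 1)
      (fun t _ => (hg t).continuousAt.continuousWithinAt)
      (fun t _ => (hg t).differentiableAt.differentiableWithinAt) fun t ht => ?_
    have ht0 : 0 ≤ t := (interior_subset ht).1
    rw [(hg t).deriv, ← inner_sub_left]
    have hcs : |⟪gradient J (x + t • v) - gradient J x, v⟫| ≤ L * ‖v‖ ^ 2 * t :=
      calc
        _ ≤ ‖gradient J (x + t • v) - gradient J x‖ * ‖v‖ := abs_real_inner_le_norm _ _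
        _ ≤ L * ‖x + t • v - x‖ * ‖v‖ := by gcongr; exact hlip _ _
        _ = L * ‖v‖ ^ 2 * t := by
          rw [add_sub_cancel_left, norm_smul, Real.norm_of_nonneg ht0]
          ring
    linarith [(abs_le.mp hcs).1]
  have h01 := hmono (Set.left_mem_Icc.mpr zero_le_one) (Set.right_mem_Icc.mpr zero_le_one)
    zero_le_one
  simp only [g, zero_smul, one_smul, add_zero] at h01
  linarith

/-- per-iteration improvement of ASGM: with an `L`-Lipschitz gradient,
`α ∈ (0,1)`, a nonzero ascent direction `s` with `⟪∇J W, s⟫ > 0`, and step size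
`Δ = 2(1-α)⟪∇J W, s⟫/(L‖s‖²)`, the objective improves by at least
`(2α(1-α)/L) * ⟪∇J W, s⟫² / ‖s‖²`. -/
theorem asgm_per_iteration_improvement
    (n : ℕ) (L α : ℝ) (hL : 0 < L) (hα0 : 0 < α) (hα1 : α < 1)
    (J : EuclideanSpace ℝ (Fin n) → ℝ) (hdiff : Differentiable ℝ J)
    (hlip : ∀ u v : EuclideanSpace ℝ (Fin n),
      ‖gradient J u - gradient J v‖ ≤ L * ‖u - v‖)
    (W s : EuclideanSpace ℝ (Fin n)) (hs : s ≠ 0)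
    (hdir : 0 < ⟪gradient J W, s⟫) :
    J (W + (2 * (1 - α) * ⟪gradient J W, s⟫ / (L * ‖s‖ ^ 2)) • s) - J W ≥
      2 * α * (1 - α) / L * ⟪gradient J W, s⟫ ^ 2 / ‖s‖ ^ 2 := by
  have hs' : 0 < ‖s‖ := norm_pos_iff.mpr hs
  have h := add_inner_gradient_sub_le_of_lipschitz_gradient hdiff hlip W
    ((2 * (1 - α) * ⟪gradient J W, s⟫ / (L * ‖s‖ ^ 2)) • s)
  rw [real_inner_smul_right, norm_smul, mul_pow, Real.norm_eq_abs, sq_abs] at h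
  have hgain : 2 * α * (1 - α) / L * ⟪gradient J W, s⟫ ^ 2 / ‖s‖ ^ 2 =
      2 * (1 - α) * ⟪gradient J W, s⟫ / (L * ‖s‖ ^ 2) * ⟪gradient J W, s⟫ -
        L / 2 * ((2 * (1 - α) * ⟪gradient J W, s⟫ / (L * ‖s‖ ^ 2)) ^ 2 * ‖s‖ ^ 2) := by
    field_simp
    ring
  rw [hgain]
  linarith
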